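/- arXiv:2307.13445 — 5 statements merged into one kernel-verified Lean document; each statement's English description precedes it below -/
import Mathlib

section
/- Let H be a g×g matrix over k. Then for every i ≥ 1 one has ρ_i(H) ≤ ρ_{i−1}(H), and the successive differences δ_i(H) := ρ_{i−1}(H) − ρ_i(H) are nonincreasing: δ_{i+1}(H) ≤ δ_i(H) for all i ≥ 1. Hence the Hasse–Witt partition δ_1 ≥ δ_2 ≥ … ≥ 0 associated with H is a well-defined partition. -/
/-!
STATEMENT 0: For a g×g matrix H over a perfect field k of characteristic p > 0,
the ranks ρ_i(H) := rank (H·H^σ·…·H^{σ^{i-1}}) (with ρ_0 = g) are nonincreasing,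
and the successive differences δ_i := ρ_{i-1} − ρ_i are nonincreasing as well,
so the Hasse–Witt partition of H is well-defined.
-/

/-- Entrywise application of `x ↦ x^(p^j)`, i.e. of `σ^j` where `σ` is the Frobenius. -/
def frobIterMat {k : Type*} [Field k] (p : ℕ) (j : ℕ) {g : ℕ}
    (H : Matrix (Fin g) (Fin g) k) : Matrix (Fin g) (Fin g) k :=
  H.map (fun x => x ^ p ^ j)

/-- `HWiter p H i = H^{(i)} = H · H^σ · … · H^{σ^{i-1}}`, with `HWiter p H 0 = 1`. -/
def HWiter {k : Type*} [Field k] (p : ℕ) {g : ℕ}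
    (H : Matrix (Fin g) (Fin g) k) : ℕ → Matrix (Fin g) (Fin g) k
  | 0 => 1
  | i + 1 => HWiter p H i * frobIterMat p i H

/-- `ρ_i(H) = rank_k H^{(i)}`; note that `ρ_0(H) = rank 1 = g`. -/
noncomputable def rhoHW {k : Type*} [Field k] (p : ℕ) {g : ℕ}
    (H : Matrix (Fin g) (Fin g) k) (i : ℕ) : ℕ :=
  (HWiter p H i).rank

namespace Matrix

theorem rank_map_ringHom {K L n : Type*} [Field K] [Field L] [Fintype n] [DecidableEq n]
    (f : K →+* L) (M : Matrix n n K) : (M.map f).rank = M.rank := by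
  classical
  obtain ⟨V, U, e, hV, hU, h⟩ := M.exists_rank_normal_form
  have hV' : IsUnit (V.map f).det :=
    (isUnit_iff_isUnit_det _).1 (hV.map f.mapMatrix)
  have hU' : IsUnit (U.map f).det :=
    (isUnit_iff_isUnit_det _).1 (hU.map f.mapMatrix)
  have hmap : V.map f * M.map f * U.map f
      = (fromBlocks 1 0 0 0 : Matrix (_ ⊕ _) (_ ⊕ _) L).submatrix e e := by
    rw [← Matrix.map_mul, ← Matrix.map_mul, h, ← submatrix_map, fromBlocks_map]
    simp
  rw [← rank_mul_eq_right_of_isUnit_det _ (M.map f) hV',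
    ← rank_mul_eq_left_of_isUnit_det _ (V.map f * M.map f) hU', hmap, rank_submatrix,
    ← diagonal_one, ← diagonal_zero, fromBlocks_diagonal, rank_diagonal]
  simp [Fintype.card_subtype, Finset.card_filter]

/-- A matrix product loses rank according to how much of the image of the right factor lies in
the kernel of the left one. -/
theorem rank_mul_add_finrank_ker_inf_range {K l m n : Type*} [Field K] [Fintype l] [Fintype m]
    [Fintype n] (A : Matrix l m K) (B : Matrix m n K) :
    (A * B).rank + Module.finrank K ↥(A.mulVecLin.ker ⊓ B.mulVecLin.range) = B.rank := by
  have h := LinearMap.finrank_range_add_finrank_ker (A.mulVecLin.domRestrict B.mulVecLin.range)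
  rw [LinearMap.range_domRestrict, ← LinearMap.range_comp, ← mulVecLin_mul,
    LinearMap.ker_domRestrict,
    (Submodule.equivSubtypeMap _ _).finrank_eq, Submodule.map_comap_subtype,
    inf_comm] at h
  exact h

/-- The Frobenius rank inequality. -/
theorem rank_mul_add_rank_mul_le {K l m n o : Type*} [Field K] [Fintype l] [Fintype m]
    [Fintype n] [Fintype o] (A : Matrix l m K) (B : Matrix m n K) (C : Matrix n o K) :
    (A * B).rank + (B * C).rank ≤ B.rank + (A * (B * C)).rank := by
  have hB := rank_mul_add_finrank_ker_inf_range A B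
  have hBC := rank_mul_add_finrank_ker_inf_range A (B * C)
  have hle : (B * C).mulVecLin.range ≤ B.mulVecLin.range := by
    rw [mulVecLin_mul]
    exact LinearMap.range_comp_le_range _ _
  have := Submodule.finrank_mono (inf_le_inf_left A.mulVecLin.ker hle)
  lia

end Matrix

theorem HWiter_succ {k : Type*} [Field k] (p : ℕ) {g : ℕ} (H : Matrix (Fin g) (Fin g) k) (i : ℕ) :
    HWiter p H (i + 1) = HWiter p H i * frobIterMat p i H :=
  rfl

theorem HWiter_succ_eq_mul_map_frobenius {k : Type*} [Field k] (p : ℕ) [ExpChar k p] {g : ℕ}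
    (H : Matrix (Fin g) (Fin g) k) (i : ℕ) :
    HWiter p H (i + 1) = H * (HWiter p H i).map (frobenius k p) := by
  induction i with
  | zero =>
    ext a b
    simp [HWiter, frobIterMat]
  | succ i ih =>
    have hfrob : frobIterMat p (i + 1) H = (frobIterMat p i H).map (frobenius k p) := by
      ext a b
      simp [frobIterMat, frobenius_def, pow_succ, pow_mul]
    rw [HWiter_succ p H (i + 1), ih, hfrob, Matrix.mul_assoc, ← Matrix.map_mul, ← HWiter_succ, ih]

theorem rhoHW_succ_le {k : Type*} [Field k] (p : ℕ) {g : ℕ} (H : Matrix (Fin g) (Fin g) k)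
    (i : ℕ) : rhoHW p H (i + 1) ≤ rhoHW p H i :=
  Matrix.rank_mul_le_left _ _

theorem rhoHW_succ_add_rhoHW_succ_le {k : Type*} [Field k] (p : ℕ) [ExpChar k p] {g : ℕ}
    (H : Matrix (Fin g) (Fin g) k) (i : ℕ) :
    rhoHW p H (i + 1) + rhoHW p H (i + 1) ≤ rhoHW p H i + rhoHW p H (i + 2) := by
  have h := Matrix.rank_mul_add_rank_mul_le H ((HWiter p H i).map (frobenius k p))
    ((frobIterMat p i H).map (frobenius k p))
  rw [← Matrix.map_mul, ← HWiter_succ, ← HWiter_succ_eq_mul_map_frobenius,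
    ← HWiter_succ_eq_mul_map_frobenius, Matrix.rank_map_ringHom, Matrix.rank_map_ringHom] at h
  exact h

theorem stmt0 {k : Type*} [Field k] [PerfectField k] (p : ℕ) [Fact p.Prime]
    [CharP k p] {g : ℕ} (H : Matrix (Fin g) (Fin g) k) :
    ∀ i : ℕ, 1 ≤ i →
      rhoHW p H i ≤ rhoHW p H (i - 1) ∧
      rhoHW p H i - rhoHW p H (i + 1) ≤ rhoHW p H (i - 1) - rhoHW p H i := by
  rintro (_ | i) hi
  · exact absurd hi (by simp)
  have hle := rhoHW_succ_le p H i
  have hconvex := rhoHW_succ_add_rhoHW_succ_le p H i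
  rw [Nat.add_sub_cancel]
  exact ⟨hle, by lia⟩
end

section
/- Let Q be a finite-dimensional k-vector space, F : Q → Q a σ-semilinear map, and Q₀ ⊆ Q a k-subspace with F(Q₀) = Q₀; set l := dim_k Q₀. Since F(Q₀) ⊆ Q₀, F induces a σ-semilinear map F̄ : Q/Q₀ → Q/Q₀. Then for every i ≥ 1: dim_k F^i(Q) = dim_k F̄^i(Q/Q₀) + l and dim_k ker(F^i) = dim_k ker(F̄^i). (This is the key step showing that the ranks of the iterated Frobenius on H^1(C, O_C) of a stable curve C with l loops exceed those of its normalization exactly by l, so that a stable curve and its normalization have the same Hasse–Witt partition and the same a-number, while the p-rank increases by l.) -/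
/-!
STATEMENT 3: Let Q be a finite-dimensional k-vector space (k perfect of
characteristic p > 0), F : Q → Q a σ-semilinear map (σ = Frobenius), and
Q₀ ⊆ Q a subspace with F(Q₀) = Q₀, l := dim_k Q₀.  If F̄ is the induced
σ-semilinear map on Q/Q₀, then for every i ≥ 1:
dim_k F^i(Q) = dim_k F̄^i(Q/Q₀) + l and dim_k ker(F^i) = dim_k ker(F̄^i).
(Images and kernels of σ-semilinear maps are k-subspaces, hence equal to
their k-spans, which is how their dimensions are expressed below.)
-/

theorem mem_iterate_comap_bot {R V : Type*} [Semiring R] [AddCommMonoid V] [Module R V]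
    {τ : R →+* R} (f : V →ₛₗ[τ] V) (n : ℕ) (x : V) :
    x ∈ (Submodule.comap f)^[n] ⊥ ↔ f^[n] x = 0 := by
  induction n generalizing x with
  | zero => simp
  | succ n ih => rw [Function.iterate_succ_apply', Submodule.mem_comap, ih,
      Function.iterate_succ_apply]

/-- A semilinear endomorphism mapping a submodule of a Noetherian module onto itself is injective
on that submodule. -/
theorem disjoint_ker_of_image_eq {R V : Type*} [Semiring R] [AddCommMonoid V] [Module R V]
    [IsNoetherian R V] {τ : R →+* R} (f : V →ₛₗ[τ] V) (W : Submodule R V)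
    (hW : f '' (W : Set V) = W) : Disjoint (LinearMap.ker f) W := by
  have hmono : Monotone fun n => (Submodule.comap f)^[n] ⊥ :=
    Monotone.monotone_iterate_of_le_map (fun _ _ h => Submodule.comap_mono h) bot_le
  obtain ⟨n, hn⟩ := monotone_stabilizes_iff_noetherian.mpr ‹IsNoetherian R V› ⟨_, hmono⟩
  rw [Submodule.disjoint_def]
  intro x hx hxW
  have himage : f^[n] '' (W : Set V) = W := by
    rw [Set.image_iterate_eq]
    exact Function.iterate_fixed hW n
  obtain ⟨y, -, rfl⟩ : x ∈ f^[n] '' (W : Set V) := by rwa [himage]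
  have hy : y ∈ (Submodule.comap f)^[n + 1] ⊥ := by
    rw [mem_iterate_comap_bot, Function.iterate_succ_apply']
    exact hx
  have hstable : (Submodule.comap f)^[n] ⊥ = (Submodule.comap f)^[n + 1] ⊥ := hn (n + 1) n.le_succ
  rwa [← hstable, mem_iterate_comap_bot] at hy

theorem finrank_map_mkQ_add {K V : Type*} [Field K] [AddCommGroup V] [Module K V]
    [FiniteDimensional K V] (S W : Submodule K V) :
    Module.finrank K (S.map W.mkQ) + Module.finrank K (S ⊓ W : Submodule K V) =
      Module.finrank K S := by
  have h := (W.mkQ.domRestrict S).finrank_range_add_finrank_ker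
  rw [LinearMap.range_domRestrict, LinearMap.ker_domRestrict, Submodule.ker_mkQ] at h
  rw [← h, ← (Submodule.comapSubtypeEquivOfLe (inf_le_left : S ⊓ W ≤ S)).finrank_eq,
    Submodule.comap_inf, Submodule.comap_subtype_self, top_inf_eq]

section Quotient

variable {K V : Type*} [Field K] [AddCommGroup V] [Module K V] [FiniteDimensional K V]
  {τ : K →+* K} (f : V →ₛₗ[τ] V) (W : Submodule K V)

theorem finrank_range_eq_finrank_range_quotient_add [RingHomSurjective τ]
    (hW : f '' (W : Set V) = W) (g : V ⧸ W →ₛₗ[τ] V ⧸ W)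
    (hg : ∀ x, g (W.mkQ x) = W.mkQ (f x)) :
    Module.finrank K (LinearMap.range f) =
      Module.finrank K (LinearMap.range g) + Module.finrank K W := by
  have hle : W ≤ LinearMap.range f := fun x hx => by
    obtain ⟨y, -, rfl⟩ := hW.superset hx
    exact ⟨y, rfl⟩
  have hmap : (LinearMap.range f).map W.mkQ = LinearMap.range g := by
    ext z
    constructor
    · rintro ⟨_, ⟨x, rfl⟩, rfl⟩
      exact ⟨W.mkQ x, hg x⟩
    · rintro ⟨w, rfl⟩
      obtain ⟨x, rfl⟩ := W.mkQ_surjective w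
      exact ⟨f x, ⟨x, rfl⟩, (hg x).symm⟩
  rw [← finrank_map_mkQ_add (LinearMap.range f) W, hmap, inf_eq_right.mpr hle]

theorem finrank_ker_eq_finrank_ker_quotient
    (hW : f '' (W : Set V) = W) (g : V ⧸ W →ₛₗ[τ] V ⧸ W)
    (hg : ∀ x, g (W.mkQ x) = W.mkQ (f x)) :
    Module.finrank K (LinearMap.ker f) = Module.finrank K (LinearMap.ker g) := by
  have hmap : (LinearMap.ker f).map W.mkQ = LinearMap.ker g := by
    ext z
    constructor
    · rintro ⟨x, hx, rfl⟩
      rw [LinearMap.mem_ker, hg, show f x = 0 from hx, map_zero]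
    · intro hz
      obtain ⟨x, rfl⟩ := W.mkQ_surjective z
      rw [LinearMap.mem_ker, hg, Submodule.mkQ_apply, Submodule.Quotient.mk_eq_zero] at hz
      obtain ⟨y, hy, hxy⟩ := hW.superset hz
      refine ⟨x - y, ?_, ?_⟩
      · simp [hxy]
      · rw [map_sub, sub_eq_self, Submodule.mkQ_apply, Submodule.Quotient.mk_eq_zero]
        exact hy
  rw [← finrank_map_mkQ_add (LinearMap.ker f) W, hmap,
    (disjoint_ker_of_image_eq f W hW).eq_bot, finrank_bot, add_zero]

end Quotient

/-- The `i`-th iterate of a Frobenius-semilinear map, as a semilinear map. -/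
def iterateSemilinear {K V : Type*} [Field K] [AddCommGroup V] [Module K V] (p : ℕ)
    [ExpChar K p] (F : V → V) (hadd : ∀ x y, F (x + y) = F x + F y)
    (hsmul : ∀ (c : K) (x : V), F (c • x) = c ^ p • F x) (i : ℕ) :
    V →ₛₗ[iterateFrobenius K p i] V where
  toFun := F^[i]
  map_add' x y := by
    induction i generalizing x y with
    | zero => rfl
    | succ i ih => simp only [Function.iterate_succ_apply, hadd, ih]
  map_smul' c x := by
    rw [iterateFrobenius_def]
    induction i generalizing c x with
    | zero => simp
    | succ i ih => simp only [Function.iterate_succ_apply, hsmul, ih, ← pow_mul, pow_succ']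

theorem stmt3 {k : Type*} [Field k] [PerfectField k] (p : ℕ) [Fact p.Prime]
    [CharP k p] {Q : Type*} [AddCommGroup Q] [Module k Q] [FiniteDimensional k Q]
    (F : Q → Q)
    (hFadd : ∀ x y : Q, F (x + y) = F x + F y)
    (hFsmul : ∀ (c : k) (x : Q), F (c • x) = c ^ p • F x)
    (Q₀ : Submodule k Q) (hQ₀ : F '' (Q₀ : Set Q) = (Q₀ : Set Q))
    (Fbar : (Q ⧸ Q₀) → (Q ⧸ Q₀))
    (hFbar : ∀ x : Q, Fbar (Submodule.Quotient.mk x) =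
      Submodule.Quotient.mk (F x)) :
    ∀ i : ℕ, 1 ≤ i →
      Module.finrank k (Submodule.span k (Set.range F^[i])) =
        Module.finrank k (Submodule.span k (Set.range Fbar^[i])) +
          Module.finrank k Q₀ ∧
      Module.finrank k (Submodule.span k (F^[i] ⁻¹' {0})) =
        Module.finrank k (Submodule.span k (Fbar^[i] ⁻¹' {0})) := by
  intro i _
  have : RingHomSurjective (iterateFrobenius k p i) := ⟨(bijective_iterateFrobenius k p i).2⟩
  have hbar_add (x y : Q ⧸ Q₀) : Fbar (x + y) = Fbar x + Fbar y := by
    obtain ⟨x, rfl⟩ := Q₀.mkQ_surjective x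
    obtain ⟨y, rfl⟩ := Q₀.mkQ_surjective y
    simp only [Submodule.mkQ_apply, ← Submodule.Quotient.mk_add, hFbar, hFadd]
  have hbar_smul (c : k) (x : Q ⧸ Q₀) : Fbar (c • x) = c ^ p • Fbar x := by
    obtain ⟨x, rfl⟩ := Q₀.mkQ_surjective x
    simp only [Submodule.mkQ_apply, ← Submodule.Quotient.mk_smul, hFbar, hFsmul]
  let f := iterateSemilinear p F hFadd hFsmul i
  let g := iterateSemilinear p Fbar hbar_add hbar_smul i
  have hf : f '' (Q₀ : Set Q) = Q₀ := by
    change F^[i] '' (Q₀ : Set Q) = Q₀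
    rw [Set.image_iterate_eq]
    exact Function.iterate_fixed hQ₀ i
  have hg (x : Q) : g (Q₀.mkQ x) = Q₀.mkQ (f x) :=
    ((Function.Semiconj.iterate_right (f := Q₀.mkQ) (fun x => (hFbar x).symm) i) x).symm
  rw [show Set.range F^[i] = LinearMap.range f from (LinearMap.coe_range f).symm,
    show Set.range Fbar^[i] = LinearMap.range g from (LinearMap.coe_range g).symm,
    show F^[i] ⁻¹' {0} = LinearMap.ker f from rfl,
    show Fbar^[i] ⁻¹' {0} = LinearMap.ker g from rfl]
  rw [Submodule.span_eq, Submodule.span_eq, Submodule.span_eq, Submodule.span_eq]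
  exact ⟨finrank_range_eq_finrank_range_quotient_add f Q₀ hf g hg,
    finrank_ker_eq_finrank_ker_quotient f Q₀ hf g hg⟩
end

section
/- Let M be a finite-dimensional k-vector space with a nondegenerate alternating k-bilinear form b : M × M → k, let F : M → M be σ-semilinear and V : M → M be σ⁻¹-semilinear, and assume b(F(x), y) = b(x, V(y))^p for all x, y ∈ M. Then (F(M))^⊥ = ker V, where N^⊥ := {m ∈ M : b(m, n) = 0 for all n ∈ N}. If moreover ker V = F(M) and dim_k M = 2g, then dim_k F(M) = dim_k ker(F) = g; in particular dim_k (M / ker F) = g. -/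
/-- Rank-nullity for a semilinear map along a bijective ring homomorphism. -/
theorem finrank_range_add_finrank_ker_of_semilinear {K L V W : Type*} [Field K] [Field L]
    [AddCommGroup V] [AddCommGroup W] [Module K V] [Module L W] [FiniteDimensional K V]
    (σ : K →+* L) [RingHomSurjective σ] (f : V →ₛₗ[σ] W) :
    Module.finrank L (LinearMap.range f) + Module.finrank K (LinearMap.ker f) =
      Module.finrank K V := by
  have e : Module.finrank K (V ⧸ LinearMap.ker f) = Module.finrank L (LinearMap.range f) := by
    rw [Module.finrank, Module.finrank, ← Cardinal.toNat_lift,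
      ← Cardinal.toNat_lift (c := Module.rank L _)]
    refine congrArg Cardinal.toNat (lift_rank_eq_of_equiv_equiv
      (M := V ⧸ LinearMap.ker f) (M' := LinearMap.range f) σ
      (QuotientAddGroup.quotientKerEquivRange f.toAddMonoidHom)
      ⟨σ.injective, RingHomSurjective.is_surjective⟩ ?_)
    rintro r ⟨x⟩
    exact Subtype.ext (f.map_smulₛₗ r x)
  rw [← e, Submodule.finrank_quotient_add_finrank]

theorem stmt6 {k : Type*} [Field k] [PerfectField k] (p : ℕ) [Fact p.Prime]
    [CharP k p] {M : Type*} [AddCommGroup M] [Module k M] [FiniteDimensional k M]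
    (b : M →ₗ[k] M →ₗ[k] k) (hbalt : ∀ x : M, b x x = 0)
    (hbnd : ∀ x : M, (∀ y : M, b x y = 0) → x = 0)
    (F : M → M)
    (hFadd : ∀ x y : M, F (x + y) = F x + F y)
    (hFsmul : ∀ (c : k) (x : M), F (c • x) = c ^ p • F x)
    (V : M → M)
    (hVadd : ∀ x y : M, V (x + y) = V x + V y)
    (hVsmul : ∀ (c : k) (x : M), V (c • x) = (frobeniusEquiv k p).symm c • V x)
    (hadj : ∀ x y : M, b (F x) y = (b x (V y)) ^ p) :
    {m : M | ∀ n ∈ Set.range F, b m n = 0} = V ⁻¹' {0} ∧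
    ∀ g : ℕ, V ⁻¹' {0} = Set.range F → Module.finrank k M = 2 * g →
      Module.finrank k (Submodule.span k (Set.range F)) = g ∧
      Module.finrank k (Submodule.span k (F ⁻¹' {0})) = g ∧
      Module.finrank k (M ⧸ Submodule.span k (F ⁻¹' {0})) = g := by
  have hrefl : LinearMap.IsRefl b := LinearMap.IsAlt.isRefl hbalt
  have hnd : b.Nondegenerate := hrefl.nondegenerate_iff_separatingLeft.mpr hbnd
  have hortho : {m : M | ∀ n ∈ Set.range F, b m n = 0} = V ⁻¹' {0} := by
    ext m
    simp only [Set.mem_ofPred_eq, Set.forall_mem_range, Set.mem_preimage, Set.mem_singleton_iff]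
    have hp : p ≠ 0 := (Fact.out : p.Prime).ne_zero
    have key : ∀ x, b m (F x) = 0 ↔ b (V m) x = 0 := fun x ↦ by
      rw [hrefl.eq_iff, hadj, pow_eq_zero_iff hp, hrefl.eq_iff]
    simp only [key]
    exact ⟨hbnd _, fun h x ↦ by simp [h]⟩
  refine ⟨hortho, fun g hVF hdim ↦ ?_⟩
  let f : M →ₛₗ[(frobeniusEquiv k p : k →+* k)] M :=
    { toFun := F, map_add' := hFadd, map_smul' := hFsmul }
  have hrange : Submodule.span k (Set.range F) = LinearMap.range f :=
    Submodule.span_eq (LinearMap.range f)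
  have hker : Submodule.span k (F ⁻¹' {0}) = LinearMap.ker f :=
    Submodule.span_eq (LinearMap.ker f)
  have hself : LinearMap.BilinForm.orthogonal b (LinearMap.range f) = LinearMap.range f := by
    ext m
    have hm : (∀ n ∈ Set.range F, b m n = 0) ↔ m ∈ Set.range F :=
      Set.ext_iff.mp (hortho.trans hVF) m
    refine Iff.trans ?_ hm
    exact forall₂_congr fun n _ ↦ hrefl.eq_iff
  have hrank := LinearMap.BilinForm.finrank_orthogonal hnd (LinearMap.range f)
  have hle := Submodule.finrank_le (LinearMap.range f)
  have hrn := finrank_range_add_finrank_ker_of_semilinear _ f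
  have hq := Submodule.finrank_quotient_add_finrank (LinearMap.ker f)
  rw [hself] at hrank
  rw [hrange, hker]
  omega
end

section
/- Let (M, F, V, b) satisfy: M is a finite-dimensional k-vector space, b : M × M → k is a nondegenerate alternating k-bilinear form, F : M → M is σ-semilinear, V : M → M is σ⁻¹-semilinear, ker F = V(M), ker V = F(M), and b(F(x), y) = b(x, V(y))^p for all x, y ∈ M. Then: (i) F(ker F) = 0, so F induces a σ-semilinear map Φ on Q := M/ker F; (ii) for every x ∈ M whose class [x] lies in ker Φ (equivalently, F(F(x)) = 0), the linear functional y ↦ b(y, F(x)) on M vanishes on ker F and on F(M), hence induces an element Ψ([x]) of (im Φ)^⊥ := {λ ∈ Q^∨ : λ vanishes on Φ(Q)}; (iii) the resulting map Ψ : ker Φ → (im Φ)^⊥ is well-defined (independent of the chosen representative x), σ-semilinear (Ψ(c·q) = c^p·Ψ(q)), and bijective. In other words, (Q, Φ, Ψ) is a Hasse–Witt triple. -/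
/-!
STATEMENT 7: Let (M, F, V, b) be a polarized mod-p Dieudonné module over a
perfect field k of characteristic p > 0: M finite-dimensional, b a
nondegenerate alternating k-bilinear form, F σ-semilinear, V σ⁻¹-semilinear,
ker F = V(M), ker V = F(M), and b(F(x), y) = b(x, V(y))^p.  Then:
(i) F(ker F) = 0, and F induces a σ-semilinear map Φ on Q := M/ker F
    (with Φ([x]) = 0 iff F(F(x)) = 0);
(ii) for every x with F(F(x)) = 0, the functional y ↦ b(y, F(x)) vanishes
     on ker F and on F(M);
(iii) the induced map Ψ : ker Φ → (im Φ)^⊥, Ψ([x]) = (class of y ↦ b(y, F(x))),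
      is well-defined, σ-semilinear and bijective onto
      (im Φ)^⊥ = {λ ∈ Q^∨ : λ vanishes on Φ(Q)}.
So (Q, Φ, Ψ) is a Hasse–Witt triple.  (ker F is a k-subspace, hence equal to
its k-span, which is how the quotient Q is formed below.)
-/

/-- The kernel of a semilinear map is its own span. -/
theorem mem_span_preimage_zero_iff {k M N : Type*} [Field k] [AddCommGroup M] [Module k M]
    [AddCommGroup N] [Module k N] (p : ℕ) (F : M → N)
    (hFadd : ∀ x y : M, F (x + y) = F x + F y)
    (hFsmul : ∀ (c : k) (x : M), F (c • x) = c ^ p • F x) (x : M) :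
    x ∈ Submodule.span k (F ⁻¹' {0}) ↔ F x = 0 := by
  refine ⟨fun hx => ?_, fun hx => Submodule.subset_span hx⟩
  induction hx using Submodule.span_induction with
  | mem x hx => exact hx
  | zero => simpa using hFadd 0 0
  | add x y _ _ hx hy => rw [hFadd, hx, hy, add_zero]
  | smul c x _ hx => rw [hFsmul, hx, smul_zero]

/-- A left-separating alternating form on a finite-dimensional space represents every functional
in its second variable. -/
theorem exists_forall_eq_apply_of_alternating {k M : Type*} [Field k] [AddCommGroup M]
    [Module k M] [FiniteDimensional k M] (b : M →ₗ[k] M →ₗ[k] k) (hb : b.IsAlt)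
    (hbnd : ∀ x : M, (∀ y : M, b x y = 0) → x = 0) (f : M →ₗ[k] k) :
    ∃ m : M, ∀ y : M, f y = b y m := by
  have hinj : Function.Injective b := by
    rw [injective_iff_map_eq_zero]
    exact fun x hx => hbnd x fun y => by rw [hx, LinearMap.zero_apply]
  have hsurj : Function.Surjective b :=
    (LinearMap.injective_iff_surjective_of_finrank_eq_finrank
      (Subspace.dual_finrank_eq (K := k) (V := M)).symm).mp hinj
  obtain ⟨m, hm⟩ := hsurj f
  exact ⟨-m, fun y => by rw [map_neg, hb.neg, hm]⟩

theorem stmt7 {k : Type*} [Field k] [PerfectField k] (p : ℕ) [Fact p.Prime]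
    [CharP k p] {M : Type*} [AddCommGroup M] [Module k M] [FiniteDimensional k M]
    (b : M →ₗ[k] M →ₗ[k] k) (hbalt : ∀ x : M, b x x = 0)
    (hbnd : ∀ x : M, (∀ y : M, b x y = 0) → x = 0)
    (F : M → M)
    (hFadd : ∀ x y : M, F (x + y) = F x + F y)
    (hFsmul : ∀ (c : k) (x : M), F (c • x) = c ^ p • F x)
    (V : M → M)
    (hVadd : ∀ x y : M, V (x + y) = V x + V y)
    (hVsmul : ∀ (c : k) (x : M), V (c • x) = (frobeniusEquiv k p).symm c • V x)
    (hkerF : F ⁻¹' {0} = Set.range V)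
    (hkerV : V ⁻¹' {0} = Set.range F)
    (hadj : ∀ x y : M, b (F x) y = (b x (V y)) ^ p) :
    -- (i) F kills its kernel ...
    F '' (F ⁻¹' {0}) ⊆ {0} ∧
    -- (ii) for x with F(F(x)) = 0, the functional y ↦ b(y, F(x)) vanishes on
    -- ker F and on im F
    (∀ x : M, F (F x) = 0 →
      (∀ y : M, F y = 0 → b y (F x) = 0) ∧ (∀ y : M, b (F y) (F x) = 0)) ∧
    -- ... hence F induces a σ-semilinear map Φ on Q = M / ker F ...
    ∃ Φ : (M ⧸ Submodule.span k (F ⁻¹' {0})) →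
        (M ⧸ Submodule.span k (F ⁻¹' {0})),
      (∀ x : M, Φ (Submodule.Quotient.mk x) = Submodule.Quotient.mk (F x)) ∧
      (∀ u v, Φ (u + v) = Φ u + Φ v) ∧
      (∀ (c : k) u, Φ (c • u) = c ^ p • Φ u) ∧
      -- ... whose kernel consists of the classes [x] with F(F(x)) = 0 ...
      (∀ x : M, Φ (Submodule.Quotient.mk x) = 0 ↔ F (F x) = 0) ∧
      -- (iii) and there is a well-defined map Ψ with Ψ([x]) induced by
      -- y ↦ b(y, F(x)) on ker Φ, which is σ-semilinear and a bijection from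
      -- ker Φ onto (im Φ)^⊥ ⊆ Q^∨
      ∃ Ψ : (M ⧸ Submodule.span k (F ⁻¹' {0})) →
          ((M ⧸ Submodule.span k (F ⁻¹' {0})) →ₗ[k] k),
        (∀ x : M, F (F x) = 0 → ∀ y : M,
          Ψ (Submodule.Quotient.mk x) (Submodule.Quotient.mk y) = b y (F x)) ∧
        (∀ q q', Φ q = 0 → Φ q' = 0 → Ψ (q + q') = Ψ q + Ψ q') ∧
        (∀ (c : k) q, Φ q = 0 → Ψ (c • q) = c ^ p • Ψ q) ∧
        (∀ q, Φ q = 0 → ∀ q', Ψ q (Φ q') = 0) ∧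
        (∀ q q', Φ q = 0 → Φ q' = 0 → Ψ q = Ψ q' → q = q') ∧
        (∀ lam : (M ⧸ Submodule.span k (F ⁻¹' {0})) →ₗ[k] k,
          (∀ q', lam (Φ q') = 0) → ∃ q, Φ q = 0 ∧ Ψ q = lam) := by
  have hb : b.IsAlt := hbalt
  have hp : p ≠ 0 := (Fact.out : p.Prime).ne_zero
  have hFsub (x y : M) : F (x - y) = F x - F y := (AddMonoidHom.mk' F hFadd).map_sub x y
  have hFV (x : M) : F (V x) = 0 := hkerF.symm.subset ⟨x, rfl⟩
  have hVF (x : M) : V (F x) = 0 := hkerV.symm.subset ⟨x, rfl⟩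
  have hmem := mem_span_preimage_zero_iff p F hFadd hFsmul
  have hvan (x : M) (hx : F (F x) = 0) :
      (∀ y : M, F y = 0 → b y (F x) = 0) ∧ ∀ y : M, b (F y) (F x) = 0 := by
    refine ⟨fun y hy => ?_, fun y => by rw [hadj, hVF, map_zero, zero_pow hp]⟩
    obtain ⟨w, hw⟩ := hkerF.subset hx
    rw [← hw, ← pow_eq_zero_iff hp, ← hadj, hy, map_zero, LinearMap.zero_apply]
  refine ⟨by rintro _ ⟨x, hx, rfl⟩; exact hx, hvan, ?_⟩
  set N := Submodule.span k (F ⁻¹' {0})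
  have hmk (x y : M) : (Submodule.Quotient.mk x : M ⧸ N) = Submodule.Quotient.mk y ↔
      F x = F y := by
    rw [Submodule.Quotient.eq, hmem, hFsub, sub_eq_zero]
  have hmk0 (x : M) : (Submodule.Quotient.mk x : M ⧸ N) = 0 ↔ F x = 0 := by
    rw [Submodule.Quotient.mk_eq_zero, hmem]
  have hΦex (q : M ⧸ N) : ∃ r : M ⧸ N, ∀ x : M, Submodule.Quotient.mk x = q →
      r = Submodule.Quotient.mk (F x) := by
    obtain ⟨x, rfl⟩ := Submodule.Quotient.mk_surjective N q
    exact ⟨Submodule.Quotient.mk (F x), fun y hy => by rw [(hmk y x).mp hy]⟩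
  choose Φ hΦ' using hΦex
  have hΦ (x : M) : Φ (Submodule.Quotient.mk x) = Submodule.Quotient.mk (F x) := hΦ' _ x rfl
  have hΦ0 (x : M) : Φ (Submodule.Quotient.mk x) = 0 ↔ F (F x) = 0 := by rw [hΦ, hmk0]
  have hΨex (q : M ⧸ N) : ∃ l : (M ⧸ N) →ₗ[k] k, ∀ x : M, Submodule.Quotient.mk x = q →
      F (F x) = 0 → ∀ y : M, l (Submodule.Quotient.mk y) = b y (F x) := by
    obtain ⟨x, rfl⟩ := Submodule.Quotient.mk_surjective N q
    by_cases hx : F (F x) = 0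
    · refine ⟨N.liftQ (b.flip (F x)) fun y hy => (hvan x hx).1 y ((hmem y).mp hy),
        fun z hz _ y => ?_⟩
      rw [(hmk z x).mp hz]
      rfl
    · exact ⟨0, fun z hz hz' => absurd ((hmk z x).mp hz ▸ hz') hx⟩
  choose Ψ hΨ' using hΨex
  have hΨ (x : M) (hx : F (F x) = 0) (y : M) :
      Ψ (Submodule.Quotient.mk x) (Submodule.Quotient.mk y) = b y (F x) := hΨ' _ x rfl hx y
  have hsurj := Submodule.Quotient.mk_surjective N
  refine ⟨Φ, hΦ, hsurj.forall₂.mpr fun x y => ?_, fun c => hsurj.forall.mpr fun x => ?_, hΦ0,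
    Ψ, hΨ, hsurj.forall₂.mpr fun x y hx hy => ?_, fun c => hsurj.forall.mpr fun x hx => ?_,
    hsurj.forall.mpr fun x hx => hsurj.forall.mpr fun y => ?_,
    hsurj.forall₂.mpr fun x y hx hy hxy => ?_, fun lam hlam => ?_⟩
  · rw [← Submodule.Quotient.mk_add, hΦ, hΦ, hΦ, hFadd, Submodule.Quotient.mk_add]
  · rw [← Submodule.Quotient.mk_smul, hΦ, hΦ, hFsmul, Submodule.Quotient.mk_smul]
  · rw [hΦ0] at hx hy
    refine LinearMap.ext (hsurj.forall.mpr fun z => ?_)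
    rw [← Submodule.Quotient.mk_add, hΨ _ (by rw [hFadd, hFadd, hx, hy, add_zero]),
      LinearMap.add_apply, hΨ x hx, hΨ y hy, hFadd, map_add]
  · rw [hΦ0] at hx
    refine LinearMap.ext (hsurj.forall.mpr fun z => ?_)
    rw [← Submodule.Quotient.mk_smul, hΨ _ (by rw [hFsmul, hFsmul, hx, smul_zero]),
      LinearMap.smul_apply, hΨ x hx, hFsmul, map_smul]
  · rw [hΦ0] at hx
    rw [hΦ, hΨ x hx, (hvan x hx).2]
  · rw [hΦ0] at hx hy
    rw [hmk, ← sub_eq_zero]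
    refine hbnd _ fun z => ?_
    rw [← hb.neg, map_sub, ← hΨ x hx, ← hΨ y hy, hxy, sub_self, neg_zero]
  · obtain ⟨m, hm⟩ := exists_forall_eq_apply_of_alternating b hb hbnd (lam.comp N.mkQ)
    have hlm (y : M) : lam (Submodule.Quotient.mk y) = b y m := hm y
    have hFm : F m = 0 := hbnd _ fun z => by
      rw [hadj, ← hb.neg, ← hlm, (hmk0 _).mpr (hFV z), map_zero, neg_zero, zero_pow hp]
    have hVm : V m = 0 := hbnd _ fun y => by
      rw [← hb.neg, neg_eq_zero, ← pow_eq_zero_iff hp, ← hadj, ← hlm, ← hΦ, hlam]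
    obtain ⟨x, rfl⟩ := hkerV.subset hVm
    refine ⟨Submodule.Quotient.mk x, (hΦ0 x).mpr hFm, LinearMap.ext (hsurj.forall.mpr fun y => ?_)⟩
    rw [hΨ x hFm, hlm]
end

section
/- Let k be an algebraically closed field of characteristic 3, let a₂, a₃, a₄, a₅, a₆, a₇, a₈ ∈ k, and let H be the 4×4 matrix over k with rows (a₂, a₅, a₈, 0), (1, a₄, a₇, 0), (0, a₃, a₆, 1), (0, a₂, a₅, a₈). Let H^σ denote the matrix obtained by cubing every entry of H. Then rank_k H = 2 and H·H^σ = 0 hold if and only if a₂ = a₃ = a₄ = a₅ = a₆ = a₇ = a₈ = 0. (Since H is the Hasse–Witt matrix of the hyperelliptic genus-4 curve y² = x⁹ + a₈x⁸ + … + a₂x² + x in characteristic 3, and the displayed condition says its Hasse–Witt partition is δ = 22, i.e., its Ekedahl–Oort type is [4,3], this shows y² = x⁹ + x is, up to isomorphism, the unique hyperelliptic genus-4 curve in characteristic 3 with Ekedahl–Oort type [4,3].) -/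
/-!
STATEMENT 8: Over an algebraically closed field k of characteristic 3, the
4×4 matrix H (the Hasse–Witt matrix of the hyperelliptic genus-4 curve
y² = x⁹ + a₈x⁸ + … + a₂x² + x) satisfies rank H = 2 and H·H^σ = 0 (where H^σ
is H with every entry cubed) if and only if a₂ = a₃ = … = a₈ = 0.  Hence
y² = x⁹ + x is the unique hyperelliptic genus-4 curve in characteristic 3
with Ekedahl–Oort type [4,3], up to isomorphism.
-/

theorem stmt8 {k : Type*} [Field k] [IsAlgClosed k] [CharP k 3]
    (a₂ a₃ a₄ a₅ a₆ a₇ a₈ : k)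
    (H : Matrix (Fin 4) (Fin 4) k)
    (hH : H = !![a₂, a₅, a₈, 0;
                 1,  a₄, a₇, 0;
                 0,  a₃, a₆, 1;
                 0,  a₂, a₅, a₈]) :
    (H.rank = 2 ∧ H * H.map (fun x => x ^ 3) = 0) ↔
      (a₂ = 0 ∧ a₃ = 0 ∧ a₄ = 0 ∧ a₅ = 0 ∧ a₆ = 0 ∧ a₇ = 0 ∧ a₈ = 0) := by
  subst hH
  constructor
  · rintro ⟨-, h⟩
    have entry (i j : Fin 4) := congrFun (congrFun h i) j
    have h₇ : a₇ = 0 := by simpa [Matrix.mul_apply, Fin.sum_univ_four] using entry 1 3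
    have h₈ : a₈ = 0 := by simpa [Matrix.mul_apply, Fin.sum_univ_four] using entry 0 3
    have h₃ : a₃ = 0 := by simpa [Matrix.mul_apply, Fin.sum_univ_four] using entry 2 0
    have h₂ : a₂ = 0 := by simpa [Matrix.mul_apply, Fin.sum_univ_four] using entry 3 0
    have h₅ : a₅ = 0 := by simpa [Matrix.mul_apply, Fin.sum_univ_four, h₈] using entry 3 3
    have h₆ : a₆ = 0 := by simpa [Matrix.mul_apply, Fin.sum_univ_four, h₈] using entry 2 3
    have h₄ : a₄ = 0 := by simpa [Matrix.mul_apply, Fin.sum_univ_four, h₂] using entry 1 0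
    exact ⟨h₂, h₃, h₄, h₅, h₆, h₇, h₈⟩
  · rintro ⟨rfl, rfl, rfl, rfl, rfl, rfl, rfl⟩
    constructor
    · have hperm : !![(0 : k), 0, 0, 0; 1, 0, 0, 0; 0, 0, 0, 1; 0, 0, 0, 0] =
          (Matrix.diagonal ![(0 : k), 1, 1, 0]).submatrix (Equiv.refl _)
            (Equiv.swap 0 1 * Equiv.swap 2 3 : Equiv.Perm (Fin 4)) := by
        ext i j
        fin_cases i <;> fin_cases j <;>
          simp [Equiv.swap_apply_def]
      classical
      rw [hperm, Matrix.rank_submatrix, Matrix.rank_diagonal, Fintype.card_subtype]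
      simp [Finset.filter, Fin.univ_succ]
    · ext i j
      fin_cases i <;> fin_cases j <;> simp [Matrix.mul_apply, Fin.sum_univ_four]
end
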